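/- arXiv:2405.07961 — 2 statements merged into one kernel-verified Lean document; each statement's English description precedes it below -/
import Mathlib

section
/- Assume the graph with node set B ∪ Ω⁺ ∪ ∂Ω and edges {x,y} with σ⁺(x,y) > 0 is connected. Then the matrix D' − I/2 is invertible. -/
open Matrix BigOperators

noncomputable section

variable {V : Type*} [Fintype V] [DecidableEq V]

/-- Weighted graph Laplacian of a symmetric weight function. -/
def lap (σ : V → V → ℝ) : Matrix V V ℝ :=
  Matrix.of fun x y => if x = y then ∑ z, σ x z else -σ x y

/-- Restriction matrix `R_X : ℝ^V → ℝ^X`. -/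
def restr (X : Finset V) : Matrix {x // x ∈ X} V ℝ :=
  Matrix.of fun i j => if (i : V) = j then 1 else 0

/-- Green function `G = R_{V°}ᵀ (L[V°,V°])⁻¹ R_{V°}` with `V° = Bᶜ`. -/
def green (B : Finset V) (σ : V → V → ℝ) : Matrix V V ℝ :=
  (restr Bᶜ)ᵀ * (restr Bᶜ * lap σ * (restr Bᶜ)ᵀ)⁻¹ * restr Bᶜ

/-- Dirichlet trace operator `γ₀ = R_{∂Ω}`. -/
def gamma0 (dO : Finset V) : Matrix {x // x ∈ dO} V ℝ := restr dO

/-- Exterior Neumann trace operator `γ₁⁺ = -R_{∂Ω} L(σ⁺)`. -/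
def gamma1p (dO : Finset V) (σp : V → V → ℝ) : Matrix {x // x ∈ dO} V ℝ :=
  -(restr dO * lap σp)

/-- Interior Neumann trace operator `γ₁⁻ = R_{∂Ω} L(σ⁻)`. -/
def gamma1m (dO : Finset V) (σm : V → V → ℝ) : Matrix {x // x ∈ dO} V ℝ :=
  restr dO * lap σm

/-- Single layer potential `𝒮 = G γ₀ᵀ`. -/
def slp (B dO : Finset V) (σ : V → V → ℝ) : Matrix V {x // x ∈ dO} ℝ :=
  green B σ * (gamma0 dO)ᵀ

/-- Exterior double layer potential `𝒟⁺ = G (γ₁⁺)ᵀ`. -/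
def dlpP (B dO : Finset V) (σ σp : V → V → ℝ) : Matrix V {x // x ∈ dO} ℝ :=
  green B σ * (gamma1p dO σp)ᵀ

/-- Interior double layer potential `𝒟⁻ = G (γ₁⁻)ᵀ`. -/
def dlpM (B dO : Finset V) (σ σm : V → V → ℝ) : Matrix V {x // x ∈ dO} ℝ :=
  green B σ * (gamma1m dO σm)ᵀ

/-- Single layer boundary operator `S = γ₀ 𝒮`. -/
def Sop (B dO : Finset V) (σ : V → V → ℝ) : Matrix {x // x ∈ dO} {x // x ∈ dO} ℝ :=
  gamma0 dO * slp B dO σ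

/-- Double layer boundary operator `D = ½ γ₀ (𝒟⁺ + 𝒟⁻)`. -/
def Dop (B dO : Finset V) (σ σp σm : V → V → ℝ) : Matrix {x // x ∈ dO} {x // x ∈ dO} ℝ :=
  (1/2 : ℝ) • (gamma0 dO * (dlpP B dO σ σp + dlpM B dO σ σm))

/-- Adjoint double layer (Neumann–Poincaré) operator `D' = ½ (γ₁⁺ + γ₁⁻) 𝒮`. -/
def Dadj (B dO : Finset V) (σ σp σm : V → V → ℝ) : Matrix {x // x ∈ dO} {x // x ∈ dO} ℝ :=
  (1/2 : ℝ) • ((gamma1p dO σp + gamma1m dO σm) * slp B dO σ)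

/-- Hypersingular operator `H = -γ₁⁺ 𝒟⁻`. -/
def Hop (B dO : Finset V) (σ σp σm : V → V → ℝ) : Matrix {x // x ∈ dO} {x // x ∈ dO} ℝ :=
  -(gamma1p dO σp * dlpM B dO σ σm)

/-- Indicator vector of a node subset. -/
def ind (X : Finset V) : V → ℝ := fun x => if x ∈ X then 1 else 0

/-- The subgraph with node set `A` and edges `{x,y}` with `w x y > 0` is connected. -/
def connOn (A : Finset V) (w : V → V → ℝ) : Prop :=
  ∀ x ∈ A, ∀ y ∈ A, Relation.ReflTransGen (fun a b => a ∈ A ∧ b ∈ A ∧ 0 < w a b) x y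

lemma restr_mulVec (X : Finset V) (u : V → ℝ) (i : {x // x ∈ X}) :
    (restr X *ᵥ u) i = u i := by
  simp [restr, Matrix.mulVec, dotProduct]

lemma restr_transpose_mulVec_mem (X : Finset V) (v : {x // x ∈ X} → ℝ) (i : {x // x ∈ X}) :
    ((restr X)ᵀ *ᵥ v) i = v i := by
  simp [restr, Matrix.mulVec, dotProduct]

lemma restr_transpose_mulVec_notMem (X : Finset V) (v : {x // x ∈ X} → ℝ) {x : V}
    (hx : x ∉ X) : ((restr X)ᵀ *ᵥ v) x = 0 := by
  simp only [restr, Matrix.mulVec, dotProduct, Matrix.transpose_apply, Matrix.of_apply]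
  refine Finset.sum_eq_zero fun i _ => ?_
  rw [if_neg, zero_mul]
  rintro rfl
  exact hx i.2

lemma lap_mulVec (w : V → V → ℝ) (hdiag : ∀ x, w x x = 0) (u : V → ℝ) (x : V) :
    (lap w *ᵥ u) x = ∑ y, w x y * (u x - u y) := by
  have h : ∀ y, lap w x y * u y = (if x = y then (∑ z, w x z) * u x else 0) - w x y * u y := by
    intro y
    by_cases hxy : x = y
    · subst hxy
      simp [lap, hdiag]
    · simp [lap, hxy]
  simp only [Matrix.mulVec, dotProduct, h, mul_sub, Finset.sum_sub_distrib, Finset.sum_mul]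
  simp

lemma lap_add (w₁ w₂ w : V → V → ℝ) (h : ∀ x y, w₁ x y + w₂ x y = w x y) :
    lap w₁ + lap w₂ = lap w := by
  ext x y
  by_cases hxy : x = y
  · simp [lap, hxy, ← h, Finset.sum_add_distrib]
  · simp [lap, hxy, ← h]
    ring

/-- The Dirichlet energy of a symmetric weight function. -/
lemma two_mul_dotProduct_lap_mulVec (w : V → V → ℝ) (hsymm : ∀ x y, w x y = w y x)
    (hdiag : ∀ x, w x x = 0) (u : V → ℝ) :
    2 * (u ⬝ᵥ lap w *ᵥ u) = ∑ x, ∑ y, w x y * (u x - u y) ^ 2 := by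
  have h₁ : u ⬝ᵥ lap w *ᵥ u = ∑ x, ∑ y, u x * (w x y * (u x - u y)) := by
    simp only [dotProduct, lap_mulVec w hdiag, Finset.mul_sum]
  have h₂ : u ⬝ᵥ lap w *ᵥ u = ∑ x, ∑ y, u y * (w x y * (u y - u x)) := by
    rw [h₁, Finset.sum_comm]
    exact Finset.sum_congr rfl fun x _ => Finset.sum_congr rfl fun y _ => by rw [hsymm x y]
  rw [two_mul]
  nth_rewrite 1 [h₁]
  rw [h₂, ← Finset.sum_add_distrib]
  refine Finset.sum_congr rfl fun x _ => ?_
  rw [← Finset.sum_add_distrib]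
  exact Finset.sum_congr rfl fun y _ => by ring

lemma eq_of_dotProduct_lap_mulVec_eq_zero (w : V → V → ℝ) (hsymm : ∀ x y, w x y = w y x)
    (hdiag : ∀ x, w x x = 0) (hnn : ∀ x y, 0 ≤ w x y) (u : V → ℝ)
    (hu : u ⬝ᵥ lap w *ᵥ u = 0) {x y : V} (hxy : 0 < w x y) : u x = u y := by
  have h := two_mul_dotProduct_lap_mulVec w hsymm hdiag u
  rw [hu, mul_zero, eq_comm] at h
  have hterm : ∀ x y, 0 ≤ w x y * (u x - u y) ^ 2 := fun x y =>
    mul_nonneg (hnn x y) (sq_nonneg _)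
  rw [Finset.sum_eq_zero_iff_of_nonneg fun x _ => Finset.sum_nonneg fun y _ => hterm x y] at h
  have h' := h x (Finset.mem_univ x)
  rw [Finset.sum_eq_zero_iff_of_nonneg fun y _ => hterm x y] at h'
  have h'' := (mul_eq_zero.1 (h' y (Finset.mem_univ y))).resolve_left hxy.ne'
  exact sub_eq_zero.1 (pow_eq_zero_iff two_ne_zero |>.1 h'')

theorem stmt_16
    {V : Type*} [Fintype V] [DecidableEq V]
    (B Op dO Om : Finset V)
    (hBne : B.Nonempty) (hOpne : Op.Nonempty) (hdOne : dO.Nonempty) (hOmne : Om.Nonempty)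
    (hd1 : Disjoint B Op) (hd2 : Disjoint B dO) (hd3 : Disjoint B Om)
    (hd4 : Disjoint Op dO) (hd5 : Disjoint Op Om) (hd6 : Disjoint dO Om)
    (hcover : B ∪ Op ∪ dO ∪ Om = Finset.univ)
    (σ σp σm : V → V → ℝ)
    (hσsymm : ∀ x y, σ x y = σ y x) (hσdiag : ∀ x, σ x x = 0)
    (hσnn : ∀ x y, 0 ≤ σ x y)
    (hsepBdO : ∀ x ∈ B, ∀ y ∈ dO, σ x y = 0)
    (hsepBOm : ∀ x ∈ B, ∀ y ∈ Om, σ x y = 0)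
    (hsepOpOm : ∀ x ∈ Op, ∀ y ∈ Om, σ x y = 0)
    (hσpsymm : ∀ x y, σp x y = σp y x) (hσpdiag : ∀ x, σp x x = 0)
    (hσmsymm : ∀ x y, σm x y = σm y x) (hσmdiag : ∀ x, σm x x = 0)
    (hσpnn : ∀ x y, 0 ≤ σp x y) (hσmnn : ∀ x y, 0 ≤ σm x y)
    (hsum : ∀ x y, σp x y + σm x y = σ x y)
    (hp1 : ∀ x y, x ∈ B ∪ Op ∨ y ∈ B ∪ Op → σp x y = σ x y)
    (hm1 : ∀ x y, x ∈ Om ∨ y ∈ Om → σm x y = σ x y)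
    (hpd : (restr Bᶜ * lap σ * (restr Bᶜ)ᵀ).PosDef)
    (hconn : connOn (B ∪ Op ∪ dO) σp) :
    IsUnit (Dadj B dO σ σp σm - (1/2 : ℝ) • (1 : Matrix {x // x ∈ dO} {x // x ∈ dO} ℝ)).det := by
  rw [← Matrix.isUnit_iff_isUnit_det, ← Matrix.mulVec_injective_iff_isUnit]
  rw [← Matrix.coe_mulVecLin, injective_iff_map_eq_zero]
  intro φ hφ
  rw [Matrix.mulVecLin_apply] at hφ
  set A := restr Bᶜ * lap σ * (restr Bᶜ)ᵀ with hA
  set f : V → ℝ := (restr dO)ᵀ *ᵥ φ with hf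
  set v := A⁻¹ *ᵥ (restr Bᶜ *ᵥ f) with hv
  set u : V → ℝ := (restr Bᶜ)ᵀ *ᵥ v with hu
  have hslp : slp B dO σ *ᵥ φ = u := by
    simp only [slp, green, gamma0, ← Matrix.mulVec_mulVec, hu, hv, hf, hA]
  have hAv : A *ᵥ v = restr Bᶜ *ᵥ f := by
    rw [hv, Matrix.mulVec_mulVec, Matrix.mul_nonsing_inv _ hpd.det_pos.ne'.isUnit,
      Matrix.one_mulVec]
  have hLu : ∀ x, x ∉ B → (lap σ *ᵥ u) x = f x := by
    intro x hx
    have h := congrFun hAv ⟨x, Finset.mem_compl.2 hx⟩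
    rwa [hA, ← Matrix.mulVec_mulVec, ← Matrix.mulVec_mulVec, restr_mulVec, restr_mulVec] at h
  have huB : ∀ x ∈ B, u x = 0 := fun x hx =>
    restr_transpose_mulVec_notMem _ _ (by simpa using hx)
  have hfout : ∀ x, x ∉ dO → f x = 0 := fun x hx => restr_transpose_mulVec_notMem _ _ hx
  have hfdO : ∀ i : {x // x ∈ dO}, f i = φ i := restr_transpose_mulVec_mem dO φ
  have hsplit : ∀ x, (lap σp *ᵥ u) x + (lap σm *ᵥ u) x = (lap σ *ᵥ u) x := fun x => by
    rw [← lap_add σp σm σ hsum, Matrix.add_mulVec, Pi.add_apply]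
  have hcov : ∀ x, x ∈ B ∨ x ∈ Op ∨ x ∈ dO ∨ x ∈ Om := by
    intro x
    have h : x ∈ B ∪ Op ∪ dO ∪ Om := hcover ▸ Finset.mem_univ x
    simpa only [Finset.mem_union, or_assoc] using h
  have hpdO : ∀ x ∈ dO, (lap σp *ᵥ u) x = 0 := by
    intro x hx
    have h := congrFun hφ ⟨x, hx⟩
    rw [Dadj, Matrix.sub_mulVec, Matrix.smul_mulVec, Matrix.smul_mulVec, Matrix.one_mulVec,
      ← Matrix.mulVec_mulVec, hslp, gamma1p, gamma1m, Matrix.add_mulVec, Matrix.neg_mulVec,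
      ← Matrix.mulVec_mulVec, ← Matrix.mulVec_mulVec] at h
    simp only [Pi.sub_apply, Pi.smul_apply, Pi.add_apply, Pi.neg_apply, restr_mulVec,
      smul_eq_mul, Pi.zero_apply] at h
    have h₁ := hsplit x
    have h₂ := hLu x (Finset.disjoint_right.1 hd2 hx)
    have h₃ := hfdO ⟨x, hx⟩
    simp only at h₃
    linarith
  have hpOp : ∀ x ∈ Op, (lap σp *ᵥ u) x = 0 := by
    intro x hx
    have h : (lap σp *ᵥ u) x = (lap σ *ᵥ u) x := by
      rw [lap_mulVec σp hσpdiag, lap_mulVec σ hσdiag]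
      exact Finset.sum_congr rfl fun y _ => by rw [hp1 x y (Or.inl (Finset.mem_union_right _ hx))]
    rw [h, hLu x (Finset.disjoint_right.1 hd1 hx), hfout x (Finset.disjoint_left.1 hd4 hx)]
  have hpOm : ∀ x ∈ Om, (lap σp *ᵥ u) x = 0 := by
    intro x hx
    rw [lap_mulVec σp hσpdiag]
    refine Finset.sum_eq_zero fun y _ => ?_
    have h₁ := hsum x y
    have h₂ := hm1 x y (Or.inl hx)
    rw [show σp x y = 0 by linarith, zero_mul]
  have henergy : u ⬝ᵥ lap σp *ᵥ u = 0 := by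
    refine Finset.sum_eq_zero fun x _ => ?_
    rcases hcov x with hx | hx | hx | hx
    · rw [huB x hx, zero_mul]
    · rw [hpOp x hx, mul_zero]
    · rw [hpdO x hx, mul_zero]
    · rw [hpOm x hx, mul_zero]
  have hudO : ∀ x ∈ dO, u x = 0 := by
    intro x hx
    obtain ⟨b, hb⟩ := hBne
    have hpath := hconn b (by simp [hb]) x (by simp [hx])
    rw [← huB b hb]
    clear hx
    induction hpath with
    | refl => rfl
    | tail _ hstep ih =>
      rw [← ih]
      exact (eq_of_dotProduct_lap_mulVec_eq_zero σp hσpsymm hσpdiag hσpnn u henergy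
        hstep.2.2).symm
  have hvAv : v ⬝ᵥ A *ᵥ v = 0 := by
    rw [hAv]
    refine Finset.sum_eq_zero fun i _ => ?_
    rw [restr_mulVec, ← restr_transpose_mulVec_mem Bᶜ v i, ← hu]
    by_cases hi : (i : V) ∈ dO
    · rw [hudO _ hi, zero_mul]
    · rw [hfout _ hi, mul_zero]
  have hv0 : v = 0 := by
    by_contra hne
    have h := hpd.dotProduct_mulVec_pos hne
    rw [star_trivial, hvAv] at h
    exact lt_irrefl _ h
  have hu0 : u = 0 := by rw [hu, hv0, Matrix.mulVec_zero]
  ext i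
  rw [← hfdO i, ← hLu i (Finset.disjoint_right.1 hd2 i.2), hu0, Matrix.mulVec_zero]
  rfl
end
end

section
/- The Neumann–Poincaré operator D' has real spectrum: every complex eigenvalue of D' (i.e., every root in ℂ of the characteristic polynomial of D' viewed as a complex matrix) is a real number. -/
open Matrix BigOperators

noncomputable section

variable {V : Type*} [Fintype V] [DecidableEq V]

open scoped ComplexOrder MatrixOrder in
/-- The characteristic polynomial of a matrix symmetrized by a positive definite one splits over `ℝ`. -/
theorem exists_charpoly_eq_prod_of_posDef_mul_isHermitian {n : Type*} [Fintype n] [DecidableEq n]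
    {S A : Matrix n n ℝ} (hS : S.PosDef) (hSA : (S * A).IsHermitian) :
    ∃ d : n → ℝ, A.charpoly = ∏ i, (Polynomial.X - Polynomial.C (d i)) := by
  obtain ⟨y, hy, rfl⟩ :=
    CStarAlgebra.isStrictlyPositive_iff_eq_star_mul_self.mp hS.isStrictlyPositive
  have hdet : IsUnit y.det := (Matrix.isUnit_iff_isUnit_det y).mp hy
  have hT : (y * A * y⁻¹).IsHermitian := by
    have h := Matrix.isHermitian_conjTranspose_mul_mul y⁻¹ hSA
    have hstar : (y⁻¹)ᴴ * yᴴ = 1 := by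
      rw [← Matrix.conjTranspose_mul, Matrix.mul_nonsing_inv _ hdet, Matrix.conjTranspose_one]
    have e : (y⁻¹)ᴴ * (star y * y * A) * y⁻¹ = y * A * y⁻¹ := by
      rw [Matrix.star_eq_conjTranspose]
      simp only [← Matrix.mul_assoc]
      rw [hstar, Matrix.one_mul]
    rwa [e] at h
  refine ⟨hT.eigenvalues, ?_⟩
  have hchar : (y * A * y⁻¹).charpoly = A.charpoly := by
    rw [Matrix.charpoly_mul_comm, ← Matrix.mul_assoc, Matrix.nonsing_inv_mul _ hdet,
      Matrix.one_mul]
  rw [← hchar, hT.charpoly_eq]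
  rfl

theorem lap_transpose {V : Type*} [Fintype V] [DecidableEq V] {w : V → V → ℝ}
    (hw : ∀ x y, w x y = w y x) : (lap w)ᵀ = lap w := by
  ext x y
  simp only [lap, Matrix.transpose_apply, Matrix.of_apply, hw y x]
  by_cases h : x = y
  · simp [h]
  · simp [h, Ne.symm h]

theorem restr_mul_transpose {V : Type*} [Fintype V] [DecidableEq V] (X : Finset V) :
    restr X * (restr X)ᵀ = 1 := by
  ext i j
  simp only [restr, Matrix.mul_apply, Matrix.transpose_apply, Matrix.of_apply, Matrix.one_apply,
    Subtype.ext_iff]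
  rw [Finset.sum_eq_single (j : V)] <;> aesop

theorem transpose_restr_mul {V : Type*} [Fintype V] [DecidableEq V] (X : Finset V) :
    (restr X)ᵀ * restr X = Matrix.diagonal (ind X) := by
  ext x y
  simp only [restr, Matrix.mul_apply, Matrix.transpose_apply, Matrix.of_apply,
    Matrix.diagonal_apply, ind]
  rw [Finset.sum_coe_sort X (fun i =>
    (if i = x then (1 : ℝ) else 0) * if i = y then 1 else 0)]
  by_cases h : x = y
  · simp [h]
  · simp [h, Ne.symm h]

theorem restr_mul_diagonal_ind {V : Type*} [Fintype V] [DecidableEq V] {X Y : Finset V}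
    (h : X ⊆ Y) : restr X * Matrix.diagonal (ind Y) = restr X := by
  ext i x
  rw [Matrix.mul_diagonal]
  by_cases hx : (i : V) = x
  · simp [restr, ind, ← hx, h i.2]
  · simp [restr, hx]

theorem green_mul_diagonal_ind {V : Type*} [Fintype V] [DecidableEq V] (B : Finset V)
    (σ : V → V → ℝ) : green B σ * Matrix.diagonal (ind Bᶜ) = green B σ := by
  rw [green, Matrix.mul_assoc, restr_mul_diagonal_ind subset_rfl]

theorem green_transpose {V : Type*} [Fintype V] [DecidableEq V] (B : Finset V)
    {σ : V → V → ℝ} (hσ : ∀ x y, σ x y = σ y x) : (green B σ)ᵀ = green B σ := by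
  simp only [green, Matrix.transpose_mul, Matrix.transpose_nonsing_inv, Matrix.transpose_transpose,
    lap_transpose hσ, Matrix.mul_assoc]

theorem diagonal_ind_mul_lap_mul_green {V : Type*} [Fintype V] [DecidableEq V] {B : Finset V}
    {σ : V → V → ℝ} (h : IsUnit (restr Bᶜ * lap σ * (restr Bᶜ)ᵀ).det) :
    Matrix.diagonal (ind Bᶜ) * lap σ * green B σ = Matrix.diagonal (ind Bᶜ) := by
  have e : (restr Bᶜ)ᵀ * restr Bᶜ * lap σ * green B σ =
      (restr Bᶜ)ᵀ * ((restr Bᶜ * lap σ * (restr Bᶜ)ᵀ) *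
        (restr Bᶜ * lap σ * (restr Bᶜ)ᵀ)⁻¹) * restr Bᶜ := by
    simp only [green, Matrix.mul_assoc]
  rw [← transpose_restr_mul, e, Matrix.mul_nonsing_inv _ h, Matrix.mul_one]

theorem posDef_Sop {V : Type*} [Fintype V] [DecidableEq V] {B dO : Finset V} {σ : V → V → ℝ}
    (hsub : dO ⊆ Bᶜ) (hpd : (restr Bᶜ * lap σ * (restr Bᶜ)ᵀ).PosDef) :
    (Sop B dO σ).PosDef := by
  have h := hpd.inv.mul_mul_conjTranspose_same (B := restr dO * (restr Bᶜ)ᵀ) ?_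
  · have e : Sop B dO σ = restr dO * (restr Bᶜ)ᵀ * (restr Bᶜ * lap σ * (restr Bᶜ)ᵀ)⁻¹ *
        (restr dO * (restr Bᶜ)ᵀ)ᴴ := by
      simp only [Sop, slp, green, gamma0, Matrix.conjTranspose_eq_transpose_of_trivial,
        Matrix.transpose_mul, Matrix.transpose_transpose, Matrix.mul_assoc]
    rwa [e]
  · refine Function.LeftInverse.injective
      (g := fun v => v ᵥ* (restr dO * (restr Bᶜ)ᵀ)ᵀ) fun v => ?_
    have e : restr dO * (restr Bᶜ)ᵀ * (restr dO * (restr Bᶜ)ᵀ)ᵀ = 1 := by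
      rw [Matrix.transpose_mul, Matrix.transpose_transpose, Matrix.mul_assoc,
        ← Matrix.mul_assoc (restr Bᶜ)ᵀ, transpose_restr_mul, ← Matrix.mul_assoc,
        restr_mul_diagonal_ind hsub, restr_mul_transpose]
    exact (Matrix.vecMul_vecMul v _ _).trans (e ▸ Matrix.vecMul_one v)

/-- Against a diagonal weight vanishing on `∂Ω`, the Green function annihilates the Laplacian of the
single layer potential. -/
theorem green_mul_diagonal_mul_lap_mul_slp {V : Type*} [Fintype V] [DecidableEq V]
    {B dO : Finset V} {σ : V → V → ℝ}
    (h : IsUnit (restr Bᶜ * lap σ * (restr Bᶜ)ᵀ).det) {e : V → ℝ} (he : ∀ x ∈ dO, e x = 0) :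
    green B σ * (Matrix.diagonal e * lap σ * slp B dO σ) = 0 := by
  have hcomm : Matrix.diagonal (ind Bᶜ) * Matrix.diagonal e =
      Matrix.diagonal e * Matrix.diagonal (ind Bᶜ) := by
    simp only [Matrix.diagonal_mul_diagonal, mul_comm]
  have hzero : Matrix.diagonal e * (gamma0 dO)ᵀ = 0 := by
    ext x i
    rw [Matrix.diagonal_mul, Matrix.transpose_apply]
    by_cases hx : (i : V) = x
    · simp [← hx, he i i.2]
    · simp [gamma0, restr, hx]
  calc green B σ * (Matrix.diagonal e * lap σ * slp B dO σ)
      = green B σ * (Matrix.diagonal (ind Bᶜ) * Matrix.diagonal e) *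
          (lap σ * green B σ) * (gamma0 dO)ᵀ := by
        rw [← Matrix.mul_assoc (green B σ) (Matrix.diagonal (ind Bᶜ)), green_mul_diagonal_ind]
        simp only [slp, Matrix.mul_assoc]
    _ = green B σ * Matrix.diagonal e *
          (Matrix.diagonal (ind Bᶜ) * lap σ * green B σ) * (gamma0 dO)ᵀ := by
        rw [hcomm]
        simp only [Matrix.mul_assoc]
    _ = green B σ * (Matrix.diagonal (ind Bᶜ) * Matrix.diagonal e) * (gamma0 dO)ᵀ := by
        rw [diagonal_ind_mul_lap_mul_green h, hcomm]
        simp only [Matrix.mul_assoc]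
    _ = 0 := by
        rw [Matrix.mul_assoc, Matrix.mul_assoc, hzero, Matrix.mul_zero, Matrix.mul_zero]

/-- Plemelj symmetrization: `S D'` is symmetric as soon as `L(σ⁻) - L(σ⁺)` agrees, off `∂Ω`, with
`L(σ)` up to a diagonal factor. -/
theorem isHermitian_Sop_mul_Dadj {V : Type*} [Fintype V] [DecidableEq V]
    {B dO : Finset V} {σ σp σm : V → V → ℝ} (hσ : ∀ x y, σ x y = σ y x)
    (hσp : ∀ x y, σp x y = σp y x) (hσm : ∀ x y, σm x y = σm y x)
    (h : IsUnit (restr Bᶜ * lap σ * (restr Bᶜ)ᵀ).det) {e : V → ℝ} (he : ∀ x ∈ dO, e x = 0)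
    (hK : Matrix.diagonal (ind dO) * (lap σm - lap σp) =
      lap σm - lap σp + Matrix.diagonal e * lap σ) :
    (Sop B dO σ * Dadj B dO σ σp σm).IsHermitian := by
  have key : Sop B dO σ * Dadj B dO σ σp σm =
      (1/2 : ℝ) • ((slp B dO σ)ᵀ * (lap σm - lap σp) * slp B dO σ) := by
    have hγ : gamma1p dO σp + gamma1m dO σm = restr dO * (lap σm - lap σp) := by
      rw [gamma1p, gamma1m, Matrix.mul_sub, neg_add_eq_sub]
    have hT : (slp B dO σ)ᵀ = gamma0 dO * green B σ := by
      rw [slp, Matrix.transpose_mul, Matrix.transpose_transpose, green_transpose B hσ]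
    calc Sop B dO σ * Dadj B dO σ σp σm
        = (1/2 : ℝ) • (gamma0 dO * (green B σ *
            (((restr dO)ᵀ * restr dO) * (lap σm - lap σp) * slp B dO σ))) := by
          rw [Dadj, hγ, Matrix.mul_smul, Sop]
          nth_rewrite 1 [slp]
          simp only [gamma0, Matrix.mul_assoc]
      _ = _ := by
          rw [transpose_restr_mul, hK, Matrix.add_mul, Matrix.mul_add,
            green_mul_diagonal_mul_lap_mul_slp h he, add_zero, hT]
          simp only [Matrix.mul_assoc]
  rw [key, Matrix.IsHermitian, Matrix.conjTranspose_eq_transpose_of_trivial]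
  simp only [Matrix.transpose_smul, Matrix.transpose_mul, Matrix.transpose_transpose,
    Matrix.transpose_sub, lap_transpose hσp, lap_transpose hσm, Matrix.mul_assoc]

theorem lap_apply_congr {V : Type*} [Fintype V] [DecidableEq V] {w w' : V → V → ℝ} {x : V}
    (h : ∀ y, w x y = w' x y) (y : V) : lap w x y = lap w' x y := by
  simp only [lap, Matrix.of_apply, h]

theorem lap_apply_eq_zero {V : Type*} [Fintype V] [DecidableEq V] {w : V → V → ℝ} {x : V}
    (h : ∀ y, w x y = 0) (y : V) : lap w x y = 0 := by
  simp [lap, h]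

theorem stmt_17
    {V : Type*} [Fintype V] [DecidableEq V]
    (B Op dO Om : Finset V)
    (hBne : B.Nonempty) (hOpne : Op.Nonempty) (hdOne : dO.Nonempty) (hOmne : Om.Nonempty)
    (hd1 : Disjoint B Op) (hd2 : Disjoint B dO) (hd3 : Disjoint B Om)
    (hd4 : Disjoint Op dO) (hd5 : Disjoint Op Om) (hd6 : Disjoint dO Om)
    (hcover : B ∪ Op ∪ dO ∪ Om = Finset.univ)
    (σ σp σm : V → V → ℝ)
    (hσsymm : ∀ x y, σ x y = σ y x) (hσdiag : ∀ x, σ x x = 0)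
    (hσnn : ∀ x y, 0 ≤ σ x y)
    (hsepBdO : ∀ x ∈ B, ∀ y ∈ dO, σ x y = 0)
    (hsepBOm : ∀ x ∈ B, ∀ y ∈ Om, σ x y = 0)
    (hsepOpOm : ∀ x ∈ Op, ∀ y ∈ Om, σ x y = 0)
    (hσpsymm : ∀ x y, σp x y = σp y x) (hσpdiag : ∀ x, σp x x = 0)
    (hσmsymm : ∀ x y, σm x y = σm y x) (hσmdiag : ∀ x, σm x x = 0)
    (hσpnn : ∀ x y, 0 ≤ σp x y) (hσmnn : ∀ x y, 0 ≤ σm x y)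
    (hsum : ∀ x y, σp x y + σm x y = σ x y)
    (hp1 : ∀ x y, x ∈ B ∪ Op ∨ y ∈ B ∪ Op → σp x y = σ x y)
    (hm1 : ∀ x y, x ∈ Om ∨ y ∈ Om → σm x y = σ x y)
    (hpd : (restr Bᶜ * lap σ * (restr Bᶜ)ᵀ).PosDef) :
    ∀ μ : ℂ, (((Dadj B dO σ σp σm).map (Complex.ofReal)).charpoly).IsRoot μ →
      ∃ r : ℝ, μ = (r : ℂ) := by
  intro μ hμ
  have hsub : dO ⊆ Bᶜ := fun x hx =>
    Finset.mem_compl.mpr fun hB => Finset.disjoint_left.mp hd2 hB hx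
  have hK : Matrix.diagonal (ind dO) * (lap σm - lap σp) =
      lap σm - lap σp + Matrix.diagonal (fun x => ind (B ∪ Op) x - ind Om x) * lap σ := by
    ext x y
    rw [Matrix.add_apply, Matrix.diagonal_mul, Matrix.diagonal_mul, Matrix.sub_apply]
    have hx : x ∈ B ∪ Op ∪ dO ∪ Om := hcover ▸ Finset.mem_univ x
    have h2 := @Finset.disjoint_left _ B dO
    have h3 := @Finset.disjoint_left _ B Om
    have h4 := @Finset.disjoint_left _ Op dO
    have h5 := @Finset.disjoint_left _ Op Om
    have h6 := @Finset.disjoint_left _ dO Om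
    rw [Finset.mem_union, Finset.mem_union] at hx
    rcases hx with (hx | hx) | hx
    · have hp := lap_apply_congr (fun z => hp1 x z (.inl hx)) y
      have hm : lap σm x y = 0 :=
        lap_apply_eq_zero (fun z => by linarith [hp1 x z (.inl hx), hsum x z]) y
      have hd : x ∉ dO := by grind
      have ho : x ∉ Om := by grind
      simp only [ind, hx, hd, ho, hp, hm, if_true, if_false]
      ring
    · have hb : x ∉ B ∪ Op := by grind
      have ho : x ∉ Om := by grind
      simp only [ind, hx, hb, ho, if_true, if_false]
      ring
    · have hm := lap_apply_congr (fun z => hm1 x z (.inl hx)) y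
      have hp : lap σp x y = 0 :=
        lap_apply_eq_zero (fun z => by linarith [hm1 x z (.inl hx), hsum x z]) y
      have hb : x ∉ B ∪ Op := by grind
      have hd : x ∉ dO := by grind
      simp only [ind, hx, hb, hd, hp, hm, if_true, if_false]
      ring
  have he : ∀ x ∈ dO, ind (B ∪ Op) x - ind Om x = 0 := by
    intro x hx
    have hb : x ∉ B ∪ Op := by
      rw [Finset.mem_union]
      rintro (hB | hO)
      exacts [Finset.disjoint_left.mp hd2 hB hx, Finset.disjoint_left.mp hd4 hO hx]
    simp [ind, hb, Finset.disjoint_left.mp hd6 hx]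
  obtain ⟨d, hd⟩ := exists_charpoly_eq_prod_of_posDef_mul_isHermitian (posDef_Sop hsub hpd)
    (isHermitian_Sop_mul_Dadj hσsymm hσpsymm hσmsymm
      ((Matrix.isUnit_iff_isUnit_det _).mp hpd.isUnit) he hK)
  have hc : ((Dadj B dO σ σp σm).map Complex.ofReal).charpoly =
      ∏ i, (Polynomial.X - Polynomial.C (d i : ℂ)) := by
    have hmap : ((Dadj B dO σ σp σm).map Complex.ofReal).charpoly = _ :=
      Matrix.charpoly_map (Dadj B dO σ σp σm) Complex.ofRealHom
    rw [hd, Polynomial.map_prod] at hmap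
    simpa using hmap
  rw [hc, Polynomial.IsRoot, Polynomial.eval_prod, Finset.prod_eq_zero_iff] at hμ
  obtain ⟨i, -, hi⟩ := hμ
  exact ⟨d i, by simpa [sub_eq_zero] using hi⟩
end
end
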